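/- Let 𝓓 = (Ω, 𝓑) be a pliable 4-hypergraph with |Ω| = n in which any two points are collinear, and fix x ∈ Ω. Then: (i) 𝓛_𝓓 = ⋃_{a,b ∈ Ω} [a,x] · π_x(𝓓) · [x,b]; (ii) for distinct a, b ∈ Ω, the sets [a,x] · π_x(𝓓) and [b,x] · π_x(𝓓) are disjoint. In particular |𝓛_𝓓| ≥ n · |π_x(𝓓)|. -/

import Mathlib

open Equiv

variable {Ω : Type*} [DecidableEq Ω] [Fintype Ω]

/-- Two points of a 4-hypergraph are collinear if they are equal or some line contains both. -/
def HGCollinear (B : Finset (Finset Ω)) (x y : Ω) : Prop :=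
  x = y ∨ ∃ b ∈ B, x ∈ b ∧ y ∈ b

/-- A 4-hypergraph is pliable if any two lines sharing three pairwise distinct points are equal. -/
def HGPliable (B : Finset (Finset Ω)) : Prop :=
  ∀ b₁ ∈ B, ∀ b₂ ∈ B, ∀ p q r : Ω, p ≠ q → p ≠ r → q ≠ r →
    p ∈ b₁ → q ∈ b₁ → r ∈ b₁ → p ∈ b₂ → q ∈ b₂ → r ∈ b₂ → b₁ = b₂

/-- `g` is the elementary move `[x,y]`: it interchanges `x` and `y`, interchanges the
remaining two points of every line through `x` and `y`, and fixes everything else.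
For `x = y` it is the identity. -/
def IsElemMove (B : Finset (Finset Ω)) (x y : Ω) (g : Equiv.Perm Ω) : Prop :=
  (x = y ∧ g = 1) ∨
  (x ≠ y ∧ (∃ b ∈ B, x ∈ b ∧ y ∈ b) ∧ g x = y ∧ g y = x ∧
    ∀ z : Ω, z ≠ x → z ≠ y →
      ((∀ b ∈ B, ¬(x ∈ b ∧ y ∈ b ∧ z ∈ b)) → g z = z) ∧
      (∀ b ∈ B, x ∈ b → y ∈ b → z ∈ b →
        ∀ w ∈ b, w ≠ x → w ≠ y → w ≠ z → g z = w))

/-- `g` is the move sequence `[a₀,…,a_k]` recorded by the list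
(elementary moves applied left to right). -/
def IsMoveSeq (B : Finset (Finset Ω)) : List Ω → Equiv.Perm Ω → Prop
  | [], _ => False
  | [_], g => g = 1
  | a :: b :: l, g => ∃ e h : Equiv.Perm Ω,
      IsElemMove B a b e ∧ IsMoveSeq B (b :: l) h ∧ g = h * e

/-- The puzzle set `𝓛_𝓓` of all move sequences. -/
def puzzleSet (B : Finset (Finset Ω)) : Set (Equiv.Perm Ω) :=
  { g | ∃ l : List Ω, IsMoveSeq B l g }

/-- The hole stabiliser `π_x(𝓓)`: all closed move sequences starting and ending at `x`. -/
def holeStab (B : Finset (Finset Ω)) (x : Ω) : Set (Equiv.Perm Ω) :=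
  { g | ∃ l : List Ω, l.head? = some x ∧ l.getLast? = some x ∧ IsMoveSeq B l g }

/-- `(Ω, B)` is a 2-(n,4,λ) design: lines have four points and every pair of distinct
points lies in exactly `lam` lines. -/
def IsTwoDesign (B : Finset (Finset Ω)) (lam : ℕ) : Prop :=
  (∀ b ∈ B, b.card = 4) ∧
  ∀ p q : Ω, p ≠ q → (B.filter fun b => p ∈ b ∧ q ∈ b).card = lam

/-- Supersimple: any two distinct lines meet in at most two points. -/
def HGSupersimple (B : Finset (Finset Ω)) : Prop :=
  ∀ b₁ ∈ B, ∀ b₂ ∈ B, b₁ ≠ b₂ → (b₁ ∩ b₂).card ≤ 2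

/-- `x ∈ overline{a,c}`: `x` is `a`, `c`, or lies on a line containing both `a` and `c`. -/
def HGLineClosure (B : Finset (Finset Ω)) (a c x : Ω) : Prop :=
  x = a ∨ x = c ∨ ∃ b ∈ B, a ∈ b ∧ c ∈ b ∧ x ∈ b

/-- A system of imprimitivity for the hole stabiliser `π_x` acting on `Ω \ {x}`,
with `ℓ` blocks each of size `k`. -/
def IsHoleBlockSystem (B : Finset (Finset Ω)) (x : Ω) (P : Finset (Finset Ω))
    (k ℓ : ℕ) : Prop :=
  P.card = ℓ ∧ 1 < k ∧ 1 < ℓ ∧ (∀ Δ ∈ P, Δ.card = k) ∧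
  (∀ a : Ω, a ≠ x → ∃! Δ : Finset Ω, Δ ∈ P ∧ a ∈ Δ) ∧
  (∀ Δ ∈ P, x ∉ Δ) ∧
  (∀ g ∈ holeStab B x, ∀ Δ ∈ P, Δ.image (⇑g) ∈ P)

set_option linter.unusedSectionVars false

theorem IsElemMove.symm {B : Finset (Finset Ω)} {x y : Ω} {g : Equiv.Perm Ω}
    (h : IsElemMove B x y g) : IsElemMove B y x g := by
  rcases h with ⟨rfl, rfl⟩ | ⟨hne, ⟨b, hb, hx, hy⟩, hgx, hgy, h⟩
  · exact Or.inl ⟨rfl, rfl⟩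
  · refine Or.inr ⟨hne.symm, ⟨b, hb, hy, hx⟩, hgy, hgx, fun z hzy hzx => ⟨fun hz => ?_, ?_⟩⟩
    · exact (h z hzx hzy).1 fun b hb hc => hz b hb ⟨hc.2.1, hc.1, hc.2.2⟩
    · intro b hb hyb hxb hzb w hw hwy hwx hwz
      exact (h z hzx hzy).2 b hb hxb hyb hzb w hw hwx hwy hwz

theorem IsElemMove.apply_left {B : Finset (Finset Ω)} {x y : Ω} {g : Equiv.Perm Ω}
    (h : IsElemMove B x y g) : g x = y := by
  rcases h with ⟨rfl, rfl⟩ | ⟨-, -, hgx, -⟩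
  · rfl
  · exact hgx

/-- A four-element set has a point besides any three given ones. -/
theorem exists_mem_ne_of_card_eq_four {b : Finset Ω} (hb : b.card = 4) (x y z : Ω) :
    ∃ w ∈ b, w ≠ x ∧ w ≠ y ∧ w ≠ z := by
  obtain ⟨w, hw, hw'⟩ := Finset.exists_mem_notMem_of_card_lt_card
    (s := {x, y, z}) (t := b) (lt_of_le_of_lt Finset.card_le_three (by omega))
  simp only [Finset.mem_insert, Finset.mem_singleton, not_or] at hw'
  exact ⟨w, hw, hw'⟩

/-- A four-element set has at most one point besides three given distinct elements. -/
theorem eq_of_mem_of_card_eq_four {b : Finset Ω} (hb : b.card = 4) {x y z w w' : Ω}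
    (hxy : x ≠ y) (hzx : z ≠ x) (hzy : z ≠ y) (hx : x ∈ b) (hy : y ∈ b) (hz : z ∈ b)
    (hw : w ∈ b ∧ w ≠ x ∧ w ≠ y ∧ w ≠ z) (hw' : w' ∈ b ∧ w' ≠ x ∧ w' ≠ y ∧ w' ≠ z) :
    w = w' := by
  by_contra hne
  have hsub : ({x, y, z, w, w'} : Finset Ω) ⊆ b := by
    intro t ht
    simp only [Finset.mem_insert, Finset.mem_singleton] at ht
    rcases ht with rfl | rfl | rfl | rfl | rfl
    exacts [hx, hy, hz, hw.1, hw'.1]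
  have hcard : ({x, y, z, w, w'} : Finset Ω).card = 5 := by
    obtain ⟨-, h1, h2, h3⟩ := hw
    obtain ⟨-, h4, h5, h6⟩ := hw'
    simp [Finset.card_insert_of_notMem, hxy, hzx.symm, hzy.symm, h1.symm, h2.symm, h3.symm,
      h4.symm, h5.symm, h6.symm, hne]
  have := Finset.card_le_card hsub
  omega

theorem IsElemMove.mul_self {B : Finset (Finset Ω)} (hlines : ∀ b ∈ B, b.card = 4)
    {x y : Ω} {g : Equiv.Perm Ω} (h : IsElemMove B x y g) : g * g = 1 := by
  rcases h with ⟨-, rfl⟩ | ⟨-, -, hgx, hgy, h⟩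
  · rfl
  ext z
  simp only [Equiv.Perm.mul_apply, Equiv.Perm.one_apply]
  by_cases hzx : z = x
  · rw [hzx, hgx, hgy]
  by_cases hzy : z = y
  · rw [hzy, hgy, hgx]
  by_cases hz : ∀ b ∈ B, ¬(x ∈ b ∧ y ∈ b ∧ z ∈ b)
  · rw [(h z hzx hzy).1 hz, (h z hzx hzy).1 hz]
  · push Not at hz
    obtain ⟨b, hb, hxb, hyb, hzb⟩ := hz
    obtain ⟨w, hwb, hwx, hwy, hwz⟩ := exists_mem_ne_of_card_eq_four (hlines b hb) x y z
    rw [(h z hzx hzy).2 b hb hxb hyb hzb w hwb hwx hwy hwz,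
      (h w hwx hwy).2 b hb hxb hyb hwb z hzb hzx hzy hwz.symm]

open Classical in
/-- The function underlying the elementary move `[x,y]`. -/
noncomputable def elemMoveFun (B : Finset (Finset Ω)) (x y z : Ω) : Ω :=
  if z = x then y else if z = y then x else
    if h : ∃ w, (w ≠ x ∧ w ≠ y ∧ w ≠ z) ∧ ∃ b ∈ B, x ∈ b ∧ y ∈ b ∧ z ∈ b ∧ w ∈ b then h.choose
    else z

theorem elemMoveFun_of_mem {B : Finset (Finset Ω)} (hlines : ∀ b ∈ B, b.card = 4)
    (hpl : HGPliable B) {x y z w : Ω} {b : Finset Ω} (hxy : x ≠ y) (hzx : z ≠ x) (hzy : z ≠ y)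
    (hb : b ∈ B) (hx : x ∈ b) (hy : y ∈ b) (hz : z ∈ b) (hw : w ∈ b)
    (hwx : w ≠ x) (hwy : w ≠ y) (hwz : w ≠ z) : elemMoveFun B x y z = w := by
  have h : ∃ w, (w ≠ x ∧ w ≠ y ∧ w ≠ z) ∧ ∃ b ∈ B, x ∈ b ∧ y ∈ b ∧ z ∈ b ∧ w ∈ b :=
    ⟨w, ⟨hwx, hwy, hwz⟩, b, hb, hx, hy, hz, hw⟩
  rw [elemMoveFun, if_neg hzx, if_neg hzy, dif_pos h]
  obtain ⟨hne, b', hb', hx', hy', hz', hw'⟩ := h.choose_spec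
  obtain rfl := hpl b hb b' hb' x y z hxy hzx.symm hzy.symm hx hy hz hx' hy' hz'
  exact eq_of_mem_of_card_eq_four (hlines b hb) hxy hzx hzy hx hy hz ⟨hw', hne⟩
    ⟨hw, hwx, hwy, hwz⟩

theorem elemMoveFun_of_forall_not {B : Finset (Finset Ω)} {x y z : Ω} (hzx : z ≠ x)
    (hzy : z ≠ y) (hz : ∀ b ∈ B, ¬(x ∈ b ∧ y ∈ b ∧ z ∈ b)) : elemMoveFun B x y z = z := by
  rw [elemMoveFun, if_neg hzx, if_neg hzy, dif_neg]
  rintro ⟨w, -, b, hb, hxb, hyb, hzb, -⟩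
  exact hz b hb ⟨hxb, hyb, hzb⟩

theorem elemMoveFun_left (B : Finset (Finset Ω)) (x y : Ω) : elemMoveFun B x y x = y :=
  if_pos rfl

theorem elemMoveFun_right (B : Finset (Finset Ω)) (x y : Ω) : elemMoveFun B x y y = x := by
  by_cases h : y = x
  · simp [elemMoveFun, h]
  · rw [elemMoveFun, if_neg h, if_pos rfl]

theorem elemMoveFun_involutive {B : Finset (Finset Ω)} (hlines : ∀ b ∈ B, b.card = 4)
    (hpl : HGPliable B) {x y : Ω} (hxy : x ≠ y) : Function.Involutive (elemMoveFun B x y) := by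
  intro z
  by_cases hzx : z = x
  · rw [hzx, elemMoveFun_left, elemMoveFun_right]
  by_cases hzy : z = y
  · rw [hzy, elemMoveFun_right, elemMoveFun_left]
  by_cases hz : ∀ b ∈ B, ¬(x ∈ b ∧ y ∈ b ∧ z ∈ b)
  · rw [elemMoveFun_of_forall_not hzx hzy hz, elemMoveFun_of_forall_not hzx hzy hz]
  · push Not at hz
    obtain ⟨b, hb, hxb, hyb, hzb⟩ := hz
    obtain ⟨w, hwb, hwx, hwy, hwz⟩ := exists_mem_ne_of_card_eq_four (hlines b hb) x y z
    rw [elemMoveFun_of_mem hlines hpl hxy hzx hzy hb hxb hyb hzb hwb hwx hwy hwz,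
      elemMoveFun_of_mem hlines hpl hxy hwx hwy hb hxb hyb hwb hzb hzx hzy hwz.symm]

theorem HGCollinear.exists_isElemMove {B : Finset (Finset Ω)} (hlines : ∀ b ∈ B, b.card = 4)
    (hpl : HGPliable B) {x y : Ω} (h : HGCollinear B x y) : ∃ e, IsElemMove B x y e := by
  by_cases hxy : x = y
  · exact ⟨1, Or.inl ⟨hxy, rfl⟩⟩
  refine ⟨(elemMoveFun_involutive hlines hpl hxy).toPerm, Or.inr ⟨hxy, h.resolve_left hxy,
    elemMoveFun_left B x y, elemMoveFun_right B x y, fun z hzx hzy =>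
      ⟨elemMoveFun_of_forall_not hzx hzy, ?_⟩⟩⟩
  intro b hb hxb hyb hzb w hwb hwx hwy hwz
  exact elemMoveFun_of_mem hlines hpl hxy hzx hzy hb hxb hyb hzb hwb hwx hwy hwz

theorem IsMoveSeq.ne_nil {B : Finset (Finset Ω)} {l : List Ω} {g : Equiv.Perm Ω}
    (h : IsMoveSeq B l g) : l ≠ [] := by
  rintro rfl
  exact h

theorem IsMoveSeq.cons {B : Finset (Finset Ω)} {a c : Ω} {l : List Ω} {e g : Equiv.Perm Ω}
    (he : IsElemMove B a c e) (hl : l.head? = some c) (h : IsMoveSeq B l g) :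
    IsMoveSeq B (a :: l) (g * e) := by
  obtain ⟨t, rfl⟩ := List.head?_eq_some_iff.mp hl
  exact ⟨e, g, he, h, rfl⟩

theorem IsMoveSeq.concat {B : Finset (Finset Ω)} {c d : Ω} {e : Equiv.Perm Ω}
    (he : IsElemMove B c d e) : ∀ {l : List Ω} {g : Equiv.Perm Ω}, l.getLast? = some c →
    IsMoveSeq B l g → IsMoveSeq B (l ++ [d]) (e * g)
  | [], _, _, h => h.elim
  | [a], g, hl, h => by
    obtain rfl : a = c := by simpa using hl
    obtain rfl : g = 1 := h
    exact ⟨e, 1, he, rfl, by simp⟩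
  | a :: b :: l, g, hl, h => by
    obtain ⟨e', g', he', hg', rfl⟩ := h
    have hl' : (b :: l).getLast? = some c := by simpa using hl
    exact ⟨e', e * g', he', IsMoveSeq.concat he hl' hg', by rw [mul_assoc]⟩

theorem IsMoveSeq.apply_head {B : Finset (Finset Ω)} {c d : Ω} :
    ∀ {l : List Ω} {g : Equiv.Perm Ω}, l.head? = some c → l.getLast? = some d →
    IsMoveSeq B l g → g c = d
  | [], _, _, _, h => h.elim
  | [a], g, hc, hd, h => by
    obtain rfl : g = 1 := h
    simp_all
  | a :: b :: l, g, hc, hd, h => by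
    obtain ⟨e, g', he, hg', rfl⟩ := h
    obtain rfl : a = c := by simpa using hc
    have hd' : (b :: l).getLast? = some d := by simpa using hd
    rw [Equiv.Perm.mul_apply, he.apply_left, IsMoveSeq.apply_head rfl hd' hg']

theorem apply_eq_self_of_mem_holeStab {B : Finset (Finset Ω)} {x : Ω} {g : Equiv.Perm Ω}
    (hg : g ∈ holeStab B x) : g x = x := by
  obtain ⟨l, hh, hl, h⟩ := hg
  exact h.apply_head hh hl

theorem mul_mem_puzzleSet {B : Finset (Finset Ω)} {a x : Ω} {g e : Equiv.Perm Ω}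
    (hg : g ∈ holeStab B x) (he : IsElemMove B a x e) : g * e ∈ puzzleSet B := by
  obtain ⟨l, hh, -, h⟩ := hg
  exact ⟨a :: l, h.cons he hh⟩

theorem mul_mul_mem_puzzleSet {B : Finset (Finset Ω)} {a b x : Ω} {g ea eb : Equiv.Perm Ω}
    (ha : IsElemMove B a x ea) (hb : IsElemMove B x b eb) (hg : g ∈ holeStab B x) :
    eb * g * ea ∈ puzzleSet B := by
  obtain ⟨l, hh, hl, h⟩ := hg
  exact ⟨a :: (l ++ [b]), (h.concat hb hl).cons ha (by simp [hh])⟩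

theorem exists_mul_mul_of_mem_puzzleSet {B : Finset (Finset Ω)}
    (hlines : ∀ b ∈ B, b.card = 4) (hpl : HGPliable B) (hcol : ∀ x y : Ω, HGCollinear B x y)
    (x : Ω) {p : Equiv.Perm Ω} (hp : p ∈ puzzleSet B) :
    ∃ a b : Ω, ∃ ea eb g : Equiv.Perm Ω, IsElemMove B a x ea ∧ IsElemMove B x b eb ∧
      g ∈ holeStab B x ∧ p = eb * g * ea := by
  obtain ⟨l, h⟩ := hp
  obtain ⟨ea, ha⟩ := (hcol (l.head h.ne_nil) x).exists_isElemMove hlines hpl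
  obtain ⟨eb, hb⟩ := (hcol x (l.getLast h.ne_nil)).exists_isElemMove hlines hpl
  refine ⟨_, _, ea, eb, eb * p * ea, ha, hb, ⟨x :: (l ++ [x]), rfl, ?_, ?_⟩, ?_⟩
  · rw [← List.cons_append, List.getLast?_concat]
  · refine (h.concat hb.symm (List.getLast?_eq_some_getLast h.ne_nil)).cons ha.symm ?_
    simp [List.head?_append, List.head?_eq_some_head h.ne_nil]
  · calc p = (eb * eb) * p * (ea * ea) := by
          rw [ha.mul_self hlines, hb.mul_self hlines, one_mul, mul_one]
      _ = eb * (eb * p * ea) * ea := by simp only [mul_assoc]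

theorem eq_of_mul_eq_mul_of_mem_holeStab {B : Finset (Finset Ω)} {x a b : Ω}
    {ea eb g₁ g₂ : Equiv.Perm Ω} (ha : IsElemMove B a x ea) (hb : IsElemMove B b x eb)
    (hg₁ : g₁ ∈ holeStab B x) (hg₂ : g₂ ∈ holeStab B x) (h : g₁ * ea = g₂ * eb) : a = b := by
  apply (g₁ * ea).injective
  conv_rhs => rw [h]
  rw [Equiv.Perm.mul_apply, Equiv.Perm.mul_apply, ha.apply_left, hb.apply_left,
    apply_eq_self_of_mem_holeStab hg₁, apply_eq_self_of_mem_holeStab hg₂]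

theorem card_mul_ncard_holeStab_le {B : Finset (Finset Ω)} (hlines : ∀ b ∈ B, b.card = 4)
    (hpl : HGPliable B) (hcol : ∀ x y : Ω, HGCollinear B x y) (x : Ω) :
    Fintype.card Ω * (holeStab B x).ncard ≤ (puzzleSet B).ncard := by
  choose e he using fun a => (hcol a x).exists_isElemMove hlines hpl
  rw [← Nat.card_eq_fintype_card, ← Set.ncard_univ, ← Set.ncard_prod]
  refine Set.ncard_le_ncard_of_injOn (fun p : Ω × Equiv.Perm Ω => p.2 * e p.1)
    (fun p hp => mul_mem_puzzleSet hp.2 (he p.1)) ?_ (Set.toFinite _)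
  rintro ⟨a, g₁⟩ h₁ ⟨b, g₂⟩ h₂ h
  obtain rfl := eq_of_mul_eq_mul_of_mem_holeStab (he a) (he b) h₁.2 h₂.2 h
  exact Prod.ext rfl (mul_right_cancel (b := e a) h)

/-- (Lemma 3.1(c)) Double coset decomposition of the puzzle set,
disjointness of the cosets `[a,x]·π_x(𝓓)`, and the bound `|𝓛_𝓓| ≥ n·|π_x(𝓓)|`. -/
theorem stmt1 (B : Finset (Finset Ω)) (n : ℕ) (hn : Fintype.card Ω = n)
    (hlines : ∀ b ∈ B, b.card = 4) (hpl : HGPliable B)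
    (hcol : ∀ x y : Ω, HGCollinear B x y) (x : Ω) :
    (puzzleSet B = { p : Equiv.Perm Ω | ∃ a b : Ω, ∃ ea eb g : Equiv.Perm Ω,
        IsElemMove B a x ea ∧ IsElemMove B x b eb ∧
        g ∈ holeStab B x ∧ p = eb * g * ea }) ∧
    (∀ a b : Ω, a ≠ b →
      ∀ ea eb : Equiv.Perm Ω, IsElemMove B a x ea → IsElemMove B b x eb →
        ∀ g₁ ∈ holeStab B x, ∀ g₂ ∈ holeStab B x, g₁ * ea ≠ g₂ * eb) ∧
    n * (holeStab B x).ncard ≤ (puzzleSet B).ncard := by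
  refine ⟨Set.Subset.antisymm
    (fun p hp => exists_mul_mul_of_mem_puzzleSet hlines hpl hcol x hp) ?_, ?_, ?_⟩
  · rintro _ ⟨a, b, ea, eb, g, ha, hb, hg, rfl⟩
    exact mul_mul_mem_puzzleSet ha hb hg
  · intro a b hab ea eb ha hb g₁ hg₁ g₂ hg₂ h
    exact hab (eq_of_mul_eq_mul_of_mem_holeStab ha hb hg₁ hg₂ h)
  · rw [← hn]
    exact card_mul_ncard_holeStab_le hlines hpl hcol x
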